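/- Let B ≤ GL_n(F_q) be the Borel subgroup of all invertible upper triangular matrices. Then the monomial Π_{i=1}^n x_i^{q^i − q^{i−1} − 1} generates a block basis for the coinvariant algebra P_B: the set of all its monomial factors projects to an F_q-basis of P/I_B. -/

import Mathlib

open MvPolynomial Finset

/-- The action of a matrix `g` on `F_q[x_1, …, x_n]`: the algebra map sending
`x_j` to `Σ_i g_{ij} x_i`. -/
noncomputable def matAct {K : Type*} [Field K] {n : ℕ} (g : Matrix (Fin n) (Fin n) K) :
    MvPolynomial (Fin n) K →ₐ[K] MvPolynomial (Fin n) K :=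
  aeval fun j => ∑ i, C (g i j) * X i

/-- The subalgebra of polynomials invariant under every matrix in `G`. -/
noncomputable def invariants {K : Type*} [Field K] {n : ℕ} (G : Set (GL (Fin n) K)) :
    Subalgebra K (MvPolynomial (Fin n) K) where
  carrier := {f | ∀ g ∈ G, matAct ((g : GL (Fin n) K) : Matrix (Fin n) (Fin n) K) f = f}
  mul_mem' := by
    intro a b ha hb g hg
    rw [map_mul, ha g hg, hb g hg]
  add_mem' := by
    intro a b ha hb g hg
    rw [map_add, ha g hg, hb g hg]
  algebraMap_mem' := by
    intro c g hg
    simp [matAct]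

/-- The ideal generated by the homogeneous `G`-invariants of positive degree;
the quotient by it is the algebra of coinvariants. -/
noncomputable def coinvIdeal {K : Type*} [Field K] {n : ℕ} (G : Set (GL (Fin n) K)) :
    Ideal (MvPolynomial (Fin n) K) :=
  Ideal.span {f | f ∈ invariants G ∧ ∃ d, 0 < d ∧ f.IsHomogeneous d}

/-- The Borel subgroup of invertible upper triangular matrices. -/
def borelSubgroup (K : Type*) [Field K] (n : ℕ) : Set (GL (Fin n) K) :=
  {g | ∀ s t : Fin n, (t : ℕ) < (s : ℕ) → (g : Matrix (Fin n) (Fin n) K) s t = 0}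

section LinearSubstitution

variable {K : Type*} [Field K] {n : ℕ}

lemma matAct_X (g : Matrix (Fin n) (Fin n) K) (j : Fin n) :
    matAct g (X j) = ∑ i, C (g i j) * X i := by
  simp [matAct]

lemma matAct_isHomogeneous (g : Matrix (Fin n) (Fin n) K) {f : MvPolynomial (Fin n) K} {d : ℕ}
    (hf : f.IsHomogeneous d) : (matAct g f).IsHomogeneous d := by
  have h := hf.aeval (fun j => ∑ i, C (g i j) * X i : Fin n → MvPolynomial (Fin n) K)
    (n := 1) fun _ => IsHomogeneous.sum _ _ _ fun _ _ => isHomogeneous_C_mul_X _ _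
  simpa [matAct] using h

lemma homogeneousComponent_matAct (g : Matrix (Fin n) (Fin n) K) (f : MvPolynomial (Fin n) K)
    (d : ℕ) :
    homogeneousComponent d (matAct g f) = matAct g (homogeneousComponent d f) := by
  conv_lhs => rw [← sum_homogeneousComponent f]
  rw [map_sum, map_sum]
  rw [Finset.sum_congr rfl fun i _ => homogeneousComponent_of_mem
    (matAct_isHomogeneous g (homogeneousComponent_isHomogeneous i f))]
  rw [Finset.sum_ite_eq]
  split_ifs with h
  · rfl
  · rw [homogeneousComponent_eq_zero d f (by simpa using h), map_zero]

/-- An invariant without constant term lies in the ideal of coinvariants. -/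
lemma mem_coinvIdeal_of_constantCoeff {G : Set (GL (Fin n) K)} {f : MvPolynomial (Fin n) K}
    (hf : f ∈ invariants G) (h0 : constantCoeff f = 0) : f ∈ coinvIdeal G := by
  rw [← sum_homogeneousComponent f]
  refine Ideal.sum_mem _ fun d _ => ?_
  rcases Nat.eq_zero_or_pos d with rfl | hd
  · rw [homogeneousComponent_zero, ← constantCoeff_eq, h0, map_zero]
    exact Ideal.zero_mem _
  · refine Ideal.subset_span ⟨fun g hg => ?_, d, hd, homogeneousComponent_isHomogeneous d f⟩
    rw [← homogeneousComponent_matAct, hf g hg]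

lemma constantCoeff_eq_zero_of_isHomogeneous {f : MvPolynomial (Fin n) K} {d : ℕ} (hd : 0 < d)
    (hf : f.IsHomogeneous d) : constantCoeff f = 0 := by
  rw [constantCoeff_eq]
  exact hf.coeff_eq_zero (by simpa using hd.ne)

/-- The linear form with coefficient vector `a`. -/
noncomputable def linForm (a : Fin n → K) : MvPolynomial (Fin n) K := ∑ i, C (a i) * X i

lemma linForm_injective : Function.Injective (linForm (K := K) (n := n)) := by
  intro a b h
  funext i
  have := congrArg (coeff (Finsupp.single i 1)) h
  simpa [linForm, coeff_sum, coeff_C_mul, coeff_X, Finsupp.single_left_inj] using this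

lemma linForm_add (a b : Fin n → K) : linForm (a + b) = linForm a + linForm b := by
  simp [linForm, add_mul, Finset.sum_add_distrib]

lemma linForm_smul (c : K) (a : Fin n → K) : linForm (c • a) = C c * linForm a := by
  simp [linForm, Finset.mul_sum, mul_assoc]

lemma linForm_zero : linForm (0 : Fin n → K) = 0 := by simp [linForm]

lemma matAct_linForm (g : Matrix (Fin n) (Fin n) K) (a : Fin n → K) :
    matAct g (linForm a) = linForm (g.mulVec a) := by
  have hC : ∀ c : K, matAct g (C c) = C c := fun c => (matAct g).commutes c
  simp only [linForm, map_sum, map_mul, matAct_X, hC, Matrix.mulVec, dotProduct, Finset.mul_sum,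
    Finset.sum_mul]
  rw [Finset.sum_comm]
  exact Finset.sum_congr rfl fun i _ => Finset.sum_congr rfl fun j _ => by ring

lemma matAct_one (f : MvPolynomial (Fin n) K) : matAct (1 : Matrix (Fin n) (Fin n) K) f = f := by
  have : matAct (1 : Matrix (Fin n) (Fin n) K) = AlgHom.id K _ := by
    ext j
    simp [matAct_X, Matrix.one_apply]
  rw [this, AlgHom.id_apply]

end LinearSubstitution

section Borel

variable {K : Type*} [Field K] {n : ℕ}

/-- Upper triangular with nonzero diagonal entries. -/
def IsBorel (g : Matrix (Fin n) (Fin n) K) : Prop :=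
  (∀ s t : Fin n, (t : ℕ) < (s : ℕ) → g s t = 0) ∧ ∀ s, g s s ≠ 0

lemma det_eq_prod_diag {g : Matrix (Fin n) (Fin n) K}
    (hg : ∀ s t : Fin n, (t : ℕ) < (s : ℕ) → g s t = 0) : g.det = ∏ s, g s s :=
  Matrix.det_of_isUpperTriangular fun s t h => hg s t h

lemma IsBorel.det_ne_zero {g : Matrix (Fin n) (Fin n) K} (hg : IsBorel g) : g.det ≠ 0 := by
  rw [det_eq_prod_diag hg.1]
  exact Finset.prod_ne_zero_iff.2 fun s _ => hg.2 s

lemma mem_invariants_borel {f : MvPolynomial (Fin n) K} :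
    f ∈ invariants (borelSubgroup K n) ↔
      ∀ g : Matrix (Fin n) (Fin n) K, IsBorel g → matAct g f = f := by
  constructor
  · intro hf g hg
    exact hf (Matrix.GeneralLinearGroup.mkOfDetNeZero g hg.det_ne_zero) hg.1
  · intro hf g hg
    refine hf g ⟨hg, fun s => ?_⟩
    have hdet : (g : Matrix (Fin n) (Fin n) K).det ≠ 0 := g.det_ne_zero
    rw [det_eq_prod_diag hg] at hdet
    exact Finset.prod_ne_zero_iff.1 hdet s (Finset.mem_univ s)

lemma isBorel_one : IsBorel (1 : Matrix (Fin n) (Fin n) K) :=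
  ⟨fun _ _ h => Matrix.one_apply_ne fun e => by subst e; exact lt_irrefl _ h, fun s => by simp⟩

/-- The block matrix with upper left block `g`, last column `(a, c)` and last row `(0, c)`. -/
def extendMatrix (g : Matrix (Fin n) (Fin n) K) (a : Fin n → K) (c : K) :
    Matrix (Fin (n + 1)) (Fin (n + 1)) K :=
  Matrix.of fun i => Fin.lastCases (motive := fun _ => Fin (n + 1) → K)
    (Fin.snoc (α := fun _ => K) 0 c)
    (fun i' => Fin.snoc (α := fun _ => K) (g i') (a i')) i

lemma IsBorel.extendMatrix {g : Matrix (Fin n) (Fin n) K} (hg : IsBorel g) (a : Fin n → K) {c : K}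
    (hc : c ≠ 0) : IsBorel (extendMatrix g a c) := by
  constructor
  · intro s t
    refine Fin.lastCases ?_ (fun s => ?_) s <;> refine Fin.lastCases ?_ (fun t => ?_) t
    · simp
    · simp [_root_.extendMatrix]
    · simp only [Fin.val_last, Fin.val_castSucc]; intro h; omega
    · simpa [_root_.extendMatrix] using hg.1 s t
  · intro s
    refine Fin.lastCases ?_ (fun s => ?_) s
    · simpa [_root_.extendMatrix] using hc
    · simpa [_root_.extendMatrix] using hg.2 s

lemma IsBorel.exists_eq_extendMatrix {g : Matrix (Fin (n + 1)) (Fin (n + 1)) K} (hg : IsBorel g) :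
    ∃ g' a c, IsBorel g' ∧ c ≠ 0 ∧ g = _root_.extendMatrix g' a c := by
  refine ⟨g.submatrix Fin.castSucc Fin.castSucc, fun i => g i.castSucc (Fin.last n),
    g (Fin.last n) (Fin.last n), ⟨fun s t h => hg.1 _ _ h, fun s => hg.2 _⟩, hg.2 _, ?_⟩
  ext s t
  refine Fin.lastCases ?_ (fun s => ?_) s <;> refine Fin.lastCases ?_ (fun t => ?_) t
  · simp [_root_.extendMatrix]
  · simpa [_root_.extendMatrix] using hg.1 _ _ (by simp)
  · simp [_root_.extendMatrix]
  · simp [_root_.extendMatrix]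

end Borel

section LastVariable

variable (K : Type*) [Field K] (n : ℕ)

/-- A polynomial in `n + 1` variables as a polynomial in the last one. -/
noncomputable def lastEquiv :
    MvPolynomial (Fin (n + 1)) K ≃ₐ[K] Polynomial (MvPolynomial (Fin n) K) :=
  (renameEquiv K finSuccEquivLast).trans (optionEquivLeft K (Fin n))

variable {K n}

@[simp] lemma lastEquiv_X_castSucc (i : Fin n) :
    lastEquiv K n (X i.castSucc) = Polynomial.C (X i) := by
  simp [lastEquiv, optionEquivLeft_X_some]

@[simp] lemma lastEquiv_X_last : lastEquiv K n (X (Fin.last n)) = Polynomial.X := by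
  simp [lastEquiv, optionEquivLeft_X_none]

@[simp] lemma lastEquiv_C (c : K) : lastEquiv K n (C c) = Polynomial.C (C c) :=
  (lastEquiv K n).commutes c

lemma lastEquiv_rename (f : MvPolynomial (Fin n) K) :
    lastEquiv K n (rename Fin.castSucc f) = Polynomial.C f := by
  have : ((lastEquiv K n).toAlgHom.comp (rename Fin.castSucc)) =
      (IsScalarTower.toAlgHom K (MvPolynomial (Fin n) K) _) := by
    ext i : 1
    simp
  exact congrArg (fun φ => φ f) this

lemma constantCoeff_eq_coeff_lastEquiv (f : MvPolynomial (Fin (n + 1)) K) :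
    constantCoeff f = constantCoeff ((lastEquiv K n f).coeff 0) := by
  have : (constantCoeff : MvPolynomial (Fin (n + 1)) K →+* K) =
      (constantCoeff.comp (Polynomial.constantCoeff)).comp
        (lastEquiv K n).toAlgHom.toRingHom := by
    ext i
    · simp
    · refine Fin.lastCases ?_ (fun i => ?_) i <;> simp
  rw [this]
  simp

/-- The action of `extendMatrix g a c`, read through `lastEquiv`. -/
noncomputable def lastAct (g : Matrix (Fin n) (Fin n) K) (a : Fin n → K) (c : K) :
    Polynomial (MvPolynomial (Fin n) K) →+* Polynomial (MvPolynomial (Fin n) K) :=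
  (Polynomial.compRingHom (Polynomial.C (C c) * Polynomial.X + Polynomial.C (linForm a))).comp
    (Polynomial.mapRingHom (matAct g).toRingHom)

lemma lastAct_apply (g : Matrix (Fin n) (Fin n) K) (a : Fin n → K) (c : K)
    (f : Polynomial (MvPolynomial (Fin n) K)) :
    lastAct g a c f = (f.map (matAct g).toRingHom).comp
      (Polynomial.C (C c) * Polynomial.X + Polynomial.C (linForm a)) := rfl

lemma lastAct_C (g : Matrix (Fin n) (Fin n) K) (a : Fin n → K) (c : K)
    (f : MvPolynomial (Fin n) K) :
    lastAct g a c (Polynomial.C f) = Polynomial.C (matAct g f) := by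
  rw [lastAct_apply, Polynomial.map_C, Polynomial.C_comp]
  rfl

lemma lastEquiv_matAct (g : Matrix (Fin n) (Fin n) K) (a : Fin n → K) (c : K)
    (f : MvPolynomial (Fin (n + 1)) K) :
    lastEquiv K n (matAct (extendMatrix g a c) f) = lastAct g a c (lastEquiv K n f) := by
  have : (lastEquiv K n).toAlgHom.toRingHom.comp
        (matAct (extendMatrix g a c)).toRingHom =
      (lastAct g a c).comp (lastEquiv K n).toAlgHom.toRingHom := by
    refine MvPolynomial.ringHom_ext (fun r => ?_) fun i => ?_
    · have h1 := (matAct (extendMatrix g a c)).commutes r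
      have h2 := (matAct g).commutes r
      simp only [algebraMap_eq] at h1 h2
      simp [h1, h2, lastAct_C]
    · refine Fin.lastCases ?_ (fun i => ?_) i
      · simp [matAct_X, lastAct_apply, Fin.sum_univ_castSucc, extendMatrix, linForm, add_comm]
      · simp [matAct_X, lastAct_C, Fin.sum_univ_castSucc, extendMatrix]
  exact congrArg (fun φ => φ f) this

lemma natDegree_lastAct_le (g : Matrix (Fin n) (Fin n) K) (a : Fin n → K) (c : K)
    (f : Polynomial (MvPolynomial (Fin n) K)) :
    (lastAct g a c f).natDegree ≤ f.natDegree := by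
  rw [lastAct_apply, Polynomial.natDegree_comp]
  calc _ ≤ (f.map (matAct g).toRingHom).natDegree * 1 :=
        Nat.mul_le_mul_left _ Polynomial.natDegree_linear_le
    _ ≤ _ := by rw [mul_one]; exact Polynomial.natDegree_map_le

lemma rename_mem_coinvIdeal {f : MvPolynomial (Fin n) K}
    (hf : f ∈ coinvIdeal (borelSubgroup K n)) :
    rename Fin.castSucc f ∈ coinvIdeal (borelSubgroup K (n + 1)) := by
  have hle : coinvIdeal (borelSubgroup K n) ≤
      (coinvIdeal (borelSubgroup K (n + 1))).comap
        (rename (R := K) (Fin.castSucc : Fin n → Fin (n + 1))) := by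
    refine Ideal.span_le.2 fun f hf => ?_
    obtain ⟨hinv, d, hd, hhom⟩ := hf
    refine Ideal.subset_span ⟨mem_invariants_borel.2 fun g hg => ?_, d, hd,
      hhom.rename_isHomogeneous⟩
    obtain ⟨g', a, c, hg', hc, rfl⟩ := hg.exists_eq_extendMatrix
    apply (lastEquiv K n).injective
    rw [lastEquiv_matAct, lastEquiv_rename, lastAct_C, mem_invariants_borel.1 hinv g' hg']
  exact hle hf

end LastVariable

section OrbitPolynomial

variable (K : Type*) [Field K] [Fintype K] (n : ℕ)

/-- The product of `(x - ℓ)^(q - 1)` over all linear forms `ℓ` in the previous variables. -/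
noncomputable def orbitPoly : Polynomial (MvPolynomial (Fin n) K) :=
  ∏ a : Fin n → K, (Polynomial.X - Polynomial.C (linForm a)) ^ (Fintype.card K - 1)

lemma orbitPoly_monic : (orbitPoly K n).Monic :=
  Polynomial.monic_prod_of_monic _ _ fun _ _ => (Polynomial.monic_X_sub_C _).pow _

lemma orbitPoly_natDegree :
    (orbitPoly K n).natDegree = Fintype.card K ^ n * (Fintype.card K - 1) := by
  rw [orbitPoly, Polynomial.natDegree_prod_of_monic _ _
    fun _ _ => (Polynomial.monic_X_sub_C _).pow _]
  simp [(Polynomial.monic_X_sub_C _).natDegree_pow]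

lemma orbitPoly_natDegree_pos : 0 < (orbitPoly K n).natDegree := by
  rw [orbitPoly_natDegree]
  have := Fintype.one_lt_card (α := K)
  exact Nat.mul_pos (pow_pos (by omega) _) (by omega)

variable {K n}

lemma lastAct_orbitPoly {g : Matrix (Fin n) (Fin n) K} (hg : g.det ≠ 0) (a : Fin n → K) {c : K}
    (hc : c ≠ 0) : lastAct g a c (orbitPoly K n) = orbitPoly K n := by
  have hu : IsUnit g := (Matrix.isUnit_iff_isUnit_det g).2 hg.isUnit
  have hcc : c * c⁻¹ = 1 := mul_inv_cancel₀ hc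
  have hlin : ∀ b : Fin n → K,
      lastAct g a c (Polynomial.X - Polynomial.C (linForm b)) =
        Polynomial.C (C c) *
          (Polynomial.X - Polynomial.C (linForm (c⁻¹ • (g.mulVec b - a)))) := by
    intro b
    have h1 : linForm (g.mulVec b) =
        linForm a + C c * linForm (c⁻¹ • (g.mulVec b - a)) := by
      rw [← linForm_smul, ← linForm_add, smul_smul, hcc, one_smul, add_sub_cancel]
    rw [map_sub, lastAct_C, matAct_linForm, h1, lastAct_apply, Polynomial.map_X, Polynomial.X_comp,
      Polynomial.C_add, Polynomial.C_mul]
    ring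
  have hbij : Function.Bijective fun b : Fin n → K => c⁻¹ • (g.mulVec b - a) := by
    refine Function.Injective.bijective_of_finite fun b b' h => ?_
    have h2 : g.mulVec b - a = g.mulVec b' - a := smul_right_injective _ (inv_ne_zero hc) h
    exact Matrix.mulVec_injective_iff_isUnit.2 hu (sub_left_injective h2)
  rw [orbitPoly, map_prod]
  simp only [map_pow, hlin, mul_pow]
  rw [Finset.prod_mul_distrib, ← Polynomial.C_pow, ← C_pow, FiniteField.pow_card_sub_one_eq_one c hc]
  simp only [C_1, Polynomial.C_1, Finset.prod_const_one, one_mul]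
  exact hbij.prod_comp fun b =>
    (Polynomial.X - Polynomial.C (linForm b)) ^ (Fintype.card K - 1)

lemma lastAct_modByMonic {g : Matrix (Fin n) (Fin n) K} (hg : g.det ≠ 0) (a : Fin n → K) {c : K}
    (hc : c ≠ 0) {f : Polynomial (MvPolynomial (Fin n) K)} (hf : lastAct g a c f = f) :
    lastAct g a c (f %ₘ orbitPoly K n) = f %ₘ orbitPoly K n := by
  have hm := orbitPoly_monic K n
  refine ((Polynomial.div_modByMonic_unique (lastAct g a c (f /ₘ orbitPoly K n)) _ hm
    ⟨?_, ?_⟩).2).symm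
  · conv_rhs => rw [← hf, ← Polynomial.modByMonic_add_div f (orbitPoly K n)]
    rw [map_add, map_mul, lastAct_orbitPoly hg a hc]
  · have hlt := Polynomial.natDegree_modByMonic_lt f hm fun h => by
      have := orbitPoly_natDegree_pos K n
      simp [h] at this
    exact Polynomial.degree_lt_degree ((natDegree_lastAct_le g a c _).trans_lt hlt)

/-- A polynomial fixed by all substitutions `x ↦ c x + ℓ` whose degree is less than that of
`orbitPoly` is constant. -/
lemma eq_C_of_lastAct_eq {f : Polynomial (MvPolynomial (Fin n) K)}
    (hdeg : f.natDegree < (orbitPoly K n).natDegree)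
    (hf : ∀ (a : Fin n → K) (c : K), c ≠ 0 → lastAct 1 a c f = f) :
    f = Polynomial.C (f.coeff 0) := by
  have happ : ∀ a c (f : Polynomial (MvPolynomial (Fin n) K)), lastAct 1 a c f =
      f.comp (Polynomial.C (C c) * Polynomial.X + Polynomial.C (linForm a)) := by
    intro a c f
    have : (matAct (1 : Matrix (Fin n) (Fin n) K)).toRingHom = RingHom.id _ :=
      RingHom.ext fun f => matAct_one f
    rw [lastAct_apply, this, Polynomial.map_id]
  have hX : Polynomial.X ^ (Fintype.card K - 1) ∣ f - Polynomial.C (f.coeff 0) := by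
    rw [Polynomial.X_pow_dvd_iff]
    intro j hj
    rcases Nat.eq_zero_or_pos j with rfl | hj0
    · simp
    rw [Polynomial.coeff_sub, Polynomial.coeff_C_of_ne_zero hj0.ne', sub_zero]
    obtain ⟨u, hu⟩ := IsCyclic.exists_generator (α := Kˣ)
    have hne : u ^ j ≠ 1 := by
      intro h
      have h1 := Nat.le_of_dvd hj0 (orderOf_dvd_of_pow_eq_one h)
      rw [orderOf_eq_card_of_forall_mem_zpowers hu, Nat.card_units, Nat.card_eq_fintype_card] at h1
      omega
    have h2 := congrArg (fun p => p.coeff j) (hf 0 u u.ne_zero)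
    simp only [happ, linForm_zero, Polynomial.C_0, add_zero, Polynomial.comp_C_mul_X_coeff] at h2
    have h3 : f.coeff j * C ((u : K) ^ j - 1) = 0 := by
      rw [C_sub, C_pow, C_1, mul_sub, mul_one, h2, sub_self]
    refine (mul_eq_zero.1 h3).resolve_right ?_
    rw [C_eq_zero, sub_eq_zero]
    exact fun h => hne (Units.ext (by simpa using h))
  have hdvd : orbitPoly K n ∣ f - Polynomial.C (f.coeff 0) := by
    refine Fintype.prod_dvd_of_isRelPrime (fun a b hab => ?_) fun a => ?_
    · refine IsRelPrime.pow ?_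
      refine (Polynomial.prime_X_sub_C _).irreducible.isRelPrime_iff_not_dvd.2 fun h => hab ?_
      rw [Polynomial.dvd_iff_isRoot] at h
      exact linForm_injective (by simpa [sub_eq_zero] using h)
    · have h1 := map_dvd (lastAct 1 (-a) 1) hX
      have h2 : linForm (-a) = - linForm a := by
        simpa using linForm_smul (-1) a
      rw [map_sub, hf _ _ one_ne_zero, lastAct_C, matAct_one, map_pow, happ, Polynomial.X_comp,
        h2] at h1
      simpa [sub_eq_add_neg] using h1
  have hz : f - Polynomial.C (f.coeff 0) = 0 := by
    refine Polynomial.eq_zero_of_dvd_of_natDegree_lt hdvd ?_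
    rwa [Polynomial.natDegree_sub_C]
  exact sub_eq_zero.1 hz

lemma orbitPoly_constantCoeff : constantCoeff ((orbitPoly K n).coeff 0) = 0 := by
  have h1 : constantCoeff ((orbitPoly K n).coeff 0) =
      (constantCoeff.comp Polynomial.constantCoeff) (orbitPoly K n) := by simp
  rw [h1, orbitPoly, map_prod]
  refine Finset.prod_eq_zero (Finset.mem_univ 0) ?_
  have := Fintype.one_lt_card (α := K)
  simp [linForm_zero, show 0 ≠ Fintype.card K - 1 by omega]

lemma lastEquiv_symm_orbitPoly_mem :
    (lastEquiv K n).symm (orbitPoly K n) ∈ coinvIdeal (borelSubgroup K (n + 1)) := by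
  refine mem_coinvIdeal_of_constantCoeff (mem_invariants_borel.2 fun g hg => ?_) ?_
  · obtain ⟨g', a, c, hg', hc, rfl⟩ := hg.exists_eq_extendMatrix
    apply (lastEquiv K n).injective
    rw [lastEquiv_matAct, AlgEquiv.apply_symm_apply, lastAct_orbitPoly hg'.det_ne_zero a hc]
  · rw [constantCoeff_eq_coeff_lastEquiv, AlgEquiv.apply_symm_apply, orbitPoly_constantCoeff]

/-- Modulo `orbitPoly`, an invariant without constant term reduces to a coinvariant relation in
the previous variables. -/
lemma exists_modByMonic_eq_C {f : MvPolynomial (Fin (n + 1)) K}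
    (hf : f ∈ invariants (borelSubgroup K (n + 1))) (h0 : constantCoeff f = 0) :
    ∃ r ∈ coinvIdeal (borelSubgroup K n),
      lastEquiv K n f %ₘ orbitPoly K n = Polynomial.C r := by
  have hm := orbitPoly_monic K n
  rw [mem_invariants_borel] at hf
  set F := lastEquiv K n f with hF
  have hfix : ∀ g a c, IsBorel g → c ≠ 0 →
      lastAct g a c (F %ₘ orbitPoly K n) = F %ₘ orbitPoly K n := by
    intro g a c hg hc
    refine lastAct_modByMonic hg.det_ne_zero a hc ?_
    rw [hF, ← lastEquiv_matAct, hf _ (hg.extendMatrix a hc)]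
  have hC := eq_C_of_lastAct_eq (Polynomial.natDegree_modByMonic_lt F hm fun h => by
      have := orbitPoly_natDegree_pos K n
      simp [h] at this) fun a c hc => hfix 1 a c isBorel_one hc
  refine ⟨_, mem_coinvIdeal_of_constantCoeff (mem_invariants_borel.2 fun g hg => ?_) ?_, hC⟩
  · have h := hfix g 0 1 hg one_ne_zero
    rw [hC, lastAct_C] at h
    exact Polynomial.C_injective h
  · have h := congrArg (fun p => constantCoeff (p.coeff 0))
      (Polynomial.modByMonic_add_div F (orbitPoly K n))
    simpa [Polynomial.mul_coeff_zero, orbitPoly_constantCoeff, hF,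
      ← constantCoeff_eq_coeff_lastEquiv, h0] using h

lemma mem_coinvIdeal_iff_dvd {f : MvPolynomial (Fin (n + 1)) K} :
    f ∈ coinvIdeal (borelSubgroup K (n + 1)) ↔
      (orbitPoly K n).map (Ideal.Quotient.mk (coinvIdeal (borelSubgroup K n))) ∣
        (lastEquiv K n f).map (Ideal.Quotient.mk (coinvIdeal (borelSubgroup K n))) := by
  set I := coinvIdeal (borelSubgroup K n)
  constructor
  · intro hf
    refine Submodule.span_induction (fun f hf => ?_) ?_ (fun f f' _ _ h h' => ?_)
      (fun a f _ h => ?_) hf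
    · obtain ⟨hinv, d, hd, hhom⟩ := hf
      obtain ⟨r, hr, hmod⟩ := exists_modByMonic_eq_C hinv
        (constantCoeff_eq_zero_of_isHomogeneous hd hhom)
      rw [← Polynomial.modByMonic_add_div (lastEquiv K n f) (orbitPoly K n), hmod,
        Polynomial.map_add, Polynomial.map_C, Ideal.Quotient.eq_zero_iff_mem.2 hr,
        Polynomial.C_0, zero_add, Polynomial.map_mul]
      exact dvd_mul_right _ _
    · simp
    · rw [map_add, Polynomial.map_add]
      exact dvd_add h h'
    · rw [smul_eq_mul, mul_comm, map_mul, Polynomial.map_mul]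
      exact dvd_mul_of_dvd_left h _
  · rintro ⟨Q', hQ'⟩
    obtain ⟨Q, rfl⟩ := Polynomial.map_surjective _ Ideal.Quotient.mk_surjective Q'
    have hmem : lastEquiv K n f - orbitPoly K n * Q ∈ I.map Polynomial.C := by
      rw [Ideal.mem_map_C_iff]
      intro j
      rw [← Ideal.Quotient.eq_zero_iff_mem, ← Polynomial.coeff_map, Polynomial.map_sub, hQ',
        Polynomial.map_mul, sub_self, Polynomial.coeff_zero]
    have hle : I.map Polynomial.C ≤ (coinvIdeal (borelSubgroup K (n + 1))).comap
        (lastEquiv K n).symm.toAlgHom.toRingHom := by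
      refine Ideal.map_le_iff_le_comap.2 fun r hr => ?_
      rw [Ideal.mem_comap, Ideal.mem_comap]
      change (lastEquiv K n).symm (Polynomial.C r) ∈ coinvIdeal (borelSubgroup K (n + 1))
      rw [← lastEquiv_rename, AlgEquiv.symm_apply_apply]
      exact rename_mem_coinvIdeal hr
    have h1 : (lastEquiv K n).symm (lastEquiv K n f - orbitPoly K n * Q) ∈
        coinvIdeal (borelSubgroup K (n + 1)) := hle hmem
    rw [map_sub, map_mul, AlgEquiv.symm_apply_apply] at h1
    have h2 := Ideal.mul_mem_right ((lastEquiv K n).symm Q) _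
      (lastEquiv_symm_orbitPoly_mem (K := K) (n := n))
    simpa using Ideal.add_mem _ h1 h2

end OrbitPolynomial

section BlockBasis

lemma linearIndependent_and_span_mk_of_basis {K B Q ι : Type*} [Field K] [CommRing B] [CommRing Q]
    [Algebra K B] [Algebra K Q] {φ : B →ₐ[K] Q} (hφ : Function.Surjective φ) {J : Ideal B}
    (hJ : ∀ f, f ∈ J ↔ φ f = 0) (b : Module.Basis ι K Q) {m : ι → B} (hm : ∀ i, φ (m i) = b i) :
    LinearIndependent K (fun i => Ideal.Quotient.mk J (m i)) ∧
      Submodule.span K (Set.range fun i => Ideal.Quotient.mk J (m i)) = ⊤ := by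
  obtain rfl : J = RingHom.ker φ := Ideal.ext hJ
  have hb : (fun i => Ideal.Quotient.mk (RingHom.ker φ) (m i)) =
      b.map (Ideal.quotientKerAlgEquivOfSurjective hφ).symm.toLinearEquiv := by
    funext i
    rw [Module.Basis.map_apply, ← hm]
    refine ((Ideal.quotientKerAlgEquivOfSurjective hφ).symm_apply_eq.2 ?_).symm
    rfl
  rw [hb]
  exact ⟨Module.Basis.linearIndependent _, Module.Basis.span_eq _⟩

/-- Exponent vectors of `n + 1` variables: those of the first `n` and that of the last one. -/
def boundedSnocEquiv {n : ℕ} (e : ℕ → ℕ) (d : ℕ) (hd : ∀ k, k ≤ e n ↔ k < d) :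
    {b : Fin (n + 1) → ℕ // ∀ s : Fin (n + 1), b s ≤ e s} ≃
      {b : Fin n → ℕ // ∀ s : Fin n, b s ≤ e s} × Fin d where
  toFun b := (⟨fun s => b.1 s.castSucc, fun s => b.2 s.castSucc⟩,
    ⟨b.1 (Fin.last n), (hd _).1 (b.2 (Fin.last n))⟩)
  invFun b := ⟨Fin.snoc (α := fun _ => ℕ) b.1.1 b.2, fun s => by
    refine Fin.lastCases ?_ (fun s => ?_) s
    · simpa using (hd _).2 b.2.2
    · simpa using b.1.2 s⟩
  left_inv b := by
    ext s
    refine Fin.lastCases ?_ (fun s => ?_) s <;> simp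
  right_inv b := by simp

end BlockBasis

lemma borel_blockBasis {K : Type*} [Field K] [Fintype K] (n : ℕ) :
    LinearIndependent K
      (fun b : {b : Fin n → ℕ //
          ∀ s : Fin n, b s ≤ Fintype.card K ^ ((s : ℕ) + 1) -
            Fintype.card K ^ (s : ℕ) - 1} =>
        Ideal.Quotient.mk (coinvIdeal (borelSubgroup K n)) (∏ s : Fin n, X s ^ b.1 s)) ∧
    Submodule.span K
      (Set.range (fun b : {b : Fin n → ℕ //
          ∀ s : Fin n, b s ≤ Fintype.card K ^ ((s : ℕ) + 1) -
            Fintype.card K ^ (s : ℕ) - 1} =>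
        Ideal.Quotient.mk (coinvIdeal (borelSubgroup K n)) (∏ s : Fin n, X s ^ b.1 s))) = ⊤ := by
  induction n with
  | zero =>
    let φ : MvPolynomial (Fin 0) K →ₐ[K] K := (isEmptyAlgEquiv K (Fin 0)).toAlgHom
    have hφ : Function.Bijective φ := (isEmptyAlgEquiv K (Fin 0)).bijective
    have : Unique {b : Fin 0 → ℕ // ∀ s : Fin 0, b s ≤ Fintype.card K ^ ((s : ℕ) + 1) -
            Fintype.card K ^ (s : ℕ) - 1} :=
      { default := ⟨Fin.elim0, fun s => s.elim0⟩
        uniq := fun b => Subtype.ext (Subsingleton.elim _ _) }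
    refine linearIndependent_and_span_mk_of_basis hφ.2 (fun f => ?_)
      (Module.Basis.singleton _ K) fun i => ?_
    · rw [map_eq_zero_iff φ hφ.1]
      constructor
      · intro hf
        have hle : coinvIdeal (borelSubgroup K 0) ≤ ⊥ := by
          refine Ideal.span_le.2 fun f hf => ?_
          obtain ⟨-, d, hd, hhom⟩ := hf
          have h := constantCoeff_eq_zero_of_isHomogeneous hd hhom
          rw [SetLike.mem_coe, Ideal.mem_bot, eq_C_of_isEmpty f, ← constantCoeff_eq, h, C_0]
        exact hle hf
      · rintro rfl
        exact Ideal.zero_mem _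
    · simp
  | succ n ih =>
    set I := coinvIdeal (borelSubgroup K n)
    let b₀ := Module.Basis.mk ih.1 ih.2.ge
    have hb₀ : ∀ i, b₀ i = Ideal.Quotient.mk I (∏ s : Fin n, X s ^ i.1 s) :=
      fun i => Module.Basis.mk_apply _ _ i
    have : Nontrivial (MvPolynomial (Fin n) K ⧸ I) :=
      ⟨⟨_, 0, ih.1.ne_zero ⟨0, fun s => Nat.zero_le _⟩⟩⟩
    set h := (orbitPoly K n).map (Ideal.Quotient.mk I) with hh
    have hm : h.Monic := (orbitPoly_monic K n).map _
    let b₁ := b₀.smulTower (AdjoinRoot.powerBasisAux' hm)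
    have hd : ∀ k, k ≤ Fintype.card K ^ (n + 1) - Fintype.card K ^ n - 1 ↔ k < h.natDegree := by
      intro k
      have h1 := orbitPoly_natDegree_pos K n
      rw [hh, (orbitPoly_monic K n).natDegree_map]
      rw [orbitPoly_natDegree, Nat.mul_sub, mul_one, ← pow_succ] at h1 ⊢
      omega
    let φ : MvPolynomial (Fin (n + 1)) K →ₐ[K] AdjoinRoot h :=
      ((AdjoinRoot.mkₐ h).restrictScalars K).comp
        ((Polynomial.mapAlgHom (Ideal.Quotient.mkₐ K I)).comp (lastEquiv K n).toAlgHom)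
    have hφ : ∀ f, φ f = AdjoinRoot.mk h ((lastEquiv K n f).map (Ideal.Quotient.mk I)) :=
      fun f => rfl
    have hsurj : Function.Surjective φ := fun y => by
      obtain ⟨y, rfl⟩ := AdjoinRoot.mk_surjective y
      obtain ⟨y, rfl⟩ := Polynomial.map_surjective _ Ideal.Quotient.mk_surjective y
      exact ⟨(lastEquiv K n).symm y, by rw [hφ, AlgEquiv.apply_symm_apply]⟩
    refine linearIndependent_and_span_mk_of_basis hsurj (fun f => ?_)
      (b₁.reindex (boundedSnocEquiv (fun s => Fintype.card K ^ (s + 1) - Fintype.card K ^ s - 1)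
        h.natDegree hd).symm) fun i => ?_
    · rw [hφ, AdjoinRoot.mk_eq_zero]
      exact mem_coinvIdeal_iff_dvd
    · rw [hφ, Module.Basis.reindex_apply, Equiv.symm_symm, Module.Basis.smulTower_apply, hb₀,
        Fin.prod_univ_castSucc]
      have hpow : ∀ j : Fin h.natDegree,
          AdjoinRoot.powerBasisAux' hm j = AdjoinRoot.root h ^ (j : ℕ) :=
        (AdjoinRoot.powerBasis' hm).basis_eq_pow
      simp [hpow, boundedSnocEquiv, Polynomial.map_prod, Polynomial.map_pow, Algebra.smul_def]

/-- for the Borel subgroup `B` of invertible upper triangular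
matrices, the monomial `Π_{i=1}^n x_i^{q^i - q^{i-1} - 1}` generates a block
basis for the coinvariant algebra `P_B`: its monomial factors project to an
`F_q`-basis of `P/I_B`. -/
theorem statement18 {K : Type*} [Field K] [Fintype K] {p r : ℕ} (hp : p.Prime)
    (hr : 0 < r) (hcard : Fintype.card K = p ^ r) (n : ℕ) :
    LinearIndependent K
      (fun b : {b : Fin n → ℕ //
          ∀ s : Fin n, b s ≤ Fintype.card K ^ ((s : ℕ) + 1) -
            Fintype.card K ^ (s : ℕ) - 1} =>
        Ideal.Quotient.mk (coinvIdeal (borelSubgroup K n)) (∏ s : Fin n, X s ^ b.1 s)) ∧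
    Submodule.span K
      (Set.range (fun b : {b : Fin n → ℕ //
          ∀ s : Fin n, b s ≤ Fintype.card K ^ ((s : ℕ) + 1) -
            Fintype.card K ^ (s : ℕ) - 1} =>
        Ideal.Quotient.mk (coinvIdeal (borelSubgroup K n)) (∏ s : Fin n, X s ^ b.1 s))) = ⊤ := by
  exact borel_blockBasis n
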